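/- Let H be a real Hilbert space and let R, S be operators with domains in H; define R + S on dom(R) ∩ dom(S) by (R+S)u := Ru + Su. If at least one of SRG(R), SRG(S) satisfies the chord property, then SRG(R+S) ⊆ SRG(R) + SRG(S), the Minkowski sum { z + w : z ∈ SRG(R), w ∈ SRG(S) }. -/

import Mathlib

open MeasureTheory Complex Set
open scoped ENNReal Classical Pointwise

/-- The set `z_R(u₁,u₂) = { (‖Ru₁−Ru₂‖/‖u₁−u₂‖)·exp(±i·∠(u₁−u₂, Ru₁−Ru₂)) } ⊆ ℂ`,
with the convention `z_R(u₁,u₂) = {0}` if `Ru₁ = Ru₂`.  Here `∠` is the angle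
`arccos(⟨u,y⟩/(‖u‖·‖y‖))` in a real Hilbert space. -/
noncomputable def zRel {E : Type*} [NormedAddCommGroup E] [InnerProductSpace ℝ E]
    (R : E → E) (u₁ u₂ : E) : Set ℂ :=
  if R u₁ = R u₂ then {0}
  else
    { (‖R u₁ - R u₂‖ / ‖u₁ - u₂‖ : ℝ) *
        Complex.exp ((InnerProductGeometry.angle (u₁ - u₂) (R u₁ - R u₂) : ℝ) * Complex.I),
      (‖R u₁ - R u₂‖ / ‖u₁ - u₂‖ : ℝ) *
        Complex.exp (-((InnerProductGeometry.angle (u₁ - u₂) (R u₁ - R u₂) : ℝ) * Complex.I)) }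

/-- The scaled relative graph of `R` over the input set `D`:
`SRG_D(R) = ⋃_{u₁ ≠ u₂ ∈ D} z_R(u₁,u₂)`. -/
noncomputable def SRG {E : Type*} [NormedAddCommGroup E] [InnerProductSpace ℝ E]
    (D : Set E) (R : E → E) : Set ℂ :=
  ⋃ u₁ ∈ D, ⋃ u₂ ∈ D, ⋃ (_ : u₁ ≠ u₂), zRel R u₁ u₂

/-- A set `S ⊆ ℂ` satisfies the chord property if for every `z ∈ S` the closed
segment `[z, conj z]` is contained in `S`. -/
def ChordProperty (S : Set ℂ) : Prop :=
  ∀ z ∈ S, segment ℝ z ((starRingEnd ℂ) z) ⊆ S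

/-- A point of `zRel` is determined, up to conjugation, by its real part and its modulus. -/
theorem mem_zRel_iff_re_normSq {E : Type*} [NormedAddCommGroup E] [InnerProductSpace ℝ E]
    {R : E → E} {u₁ u₂ : E} (h : u₁ ≠ u₂) (z : ℂ) :
    z ∈ zRel R u₁ u₂ ↔ z.re = inner ℝ (u₁ - u₂) (R u₁ - R u₂) / ‖u₁ - u₂‖ ^ 2 ∧
      z.re ^ 2 + z.im ^ 2 = (‖R u₁ - R u₂‖ / ‖u₁ - u₂‖) ^ 2 := by
  have hu : ‖u₁ - u₂‖ ≠ 0 := norm_ne_zero_iff.2 (sub_ne_zero.2 h)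
  unfold zRel
  split_ifs with hR
  · simp only [hR, sub_self, inner_zero_right, norm_zero, zero_div, mem_singleton_iff]
    constructor
    · rintro rfl
      simp
    · rintro ⟨h₁, h₂⟩
      apply Complex.ext
      · exact h₁
      · simpa [h₁] using h₂
  · have hy : ‖R u₁ - R u₂‖ ≠ 0 := norm_ne_zero_iff.2 (sub_ne_zero.2 hR)
    have hcos := InnerProductGeometry.cos_angle (u₁ - u₂) (R u₁ - R u₂)
    set θ := InnerProductGeometry.angle (u₁ - u₂) (R u₁ - R u₂)
    set r := ‖R u₁ - R u₂‖ / ‖u₁ - u₂‖ with hr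
    have hre : inner ℝ (u₁ - u₂) (R u₁ - R u₂) / ‖u₁ - u₂‖ ^ 2 = r * Real.cos θ := by
      rw [hcos, hr]
      field_simp
    have hneg : -((θ : ℂ) * Complex.I) = ((-θ : ℝ) : ℂ) * Complex.I := by
      push_cast
      ring
    rw [hre, hneg]
    simp only [mem_insert_iff, mem_singleton_iff, Complex.ext_iff, Complex.re_ofReal_mul,
      Complex.im_ofReal_mul, Complex.exp_ofReal_mul_I_re, Complex.exp_ofReal_mul_I_im,
      Real.cos_neg, Real.sin_neg, mul_neg]
    rw [← and_or_left, ← sq_eq_sq_iff_eq_or_eq_neg]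
    refine and_congr_right fun h₁ => ?_
    rw [h₁]
    have hsc := Real.sin_sq_add_cos_sq θ
    constructor <;> intro h₂
    · linear_combination h₂ + r ^ 2 * hsc
    · linear_combination h₂ - r ^ 2 * hsc

/-- The imaginary part of a point of `zRel` measures the component of the output increment
orthogonal to the input increment. -/
theorem mem_zRel_iff {E : Type*} [NormedAddCommGroup E] [InnerProductSpace ℝ E]
    {R : E → E} {u₁ u₂ : E} (h : u₁ ≠ u₂) (z : ℂ) :
    z ∈ zRel R u₁ u₂ ↔ z.re = inner ℝ (u₁ - u₂) (R u₁ - R u₂) / ‖u₁ - u₂‖ ^ 2 ∧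
      |z.im| = ‖(R u₁ - R u₂) - (inner ℝ (u₁ - u₂) (R u₁ - R u₂) / ‖u₁ - u₂‖ ^ 2) •
        (u₁ - u₂)‖ / ‖u₁ - u₂‖ := by
  have hu : ‖u₁ - u₂‖ ≠ 0 := norm_ne_zero_iff.2 (sub_ne_zero.2 h)
  rw [mem_zRel_iff_re_normSq h]
  refine and_congr_right fun h₁ => ?_
  generalize u₁ - u₂ = u at *
  generalize R u₁ - R u₂ = y at *
  rw [← sq_eq_sq₀ (abs_nonneg z.im) (by positivity), sq_abs, div_pow, div_pow, norm_sub_sq_real,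
    norm_smul, real_inner_smul_right, real_inner_comm u y, mul_pow, Real.norm_eq_abs, sq_abs, h₁]
  generalize inner ℝ u y = a
  have key : (‖y‖ ^ 2 - 2 * (a / ‖u‖ ^ 2 * a) + (a / ‖u‖ ^ 2) ^ 2 * ‖u‖ ^ 2) / ‖u‖ ^ 2 =
      ‖y‖ ^ 2 / ‖u‖ ^ 2 - (a / ‖u‖ ^ 2) ^ 2 := by
    field_simp
    ring
  rw [key, eq_sub_iff_add_eq']

theorem mem_SRG_iff {E : Type*} [NormedAddCommGroup E] [InnerProductSpace ℝ E]
    {D : Set E} {R : E → E} {z : ℂ} :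
    z ∈ SRG D R ↔ ∃ u₁ ∈ D, ∃ u₂ ∈ D, u₁ ≠ u₂ ∧ z ∈ zRel R u₁ u₂ := by
  simp only [SRG, mem_iUnion, exists_prop]

theorem ChordProperty.mem_of_re_eq_of_abs_im_le {S : Set ℂ} (hS : ChordProperty S) {z w : ℂ}
    (hz : z ∈ S) (hre : w.re = z.re) (him : |w.im| ≤ |z.im|) : w ∈ S := by
  apply hS z hz
  obtain h₀ | h₀ := eq_or_ne z.im 0
  · have hw : w = z := Complex.ext hre (by simpa [h₀] using him)
    exact hw ▸ left_mem_segment ℝ _ _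
  · have hq : |w.im / z.im| ≤ 1 := by
      rw [abs_div]
      exact div_le_one_of_le₀ him (abs_nonneg _)
    obtain ⟨h₁, h₂⟩ := abs_le.1 hq
    refine ⟨(1 + w.im / z.im) / 2, (1 - w.im / z.im) / 2, by linarith, by linarith, by ring, ?_⟩
    apply Complex.ext
    · simp [hre]
      ring
    · simp
      field_simp
      ring

theorem SRG_add_subset_of_chordProperty_right {H : Type*} [NormedAddCommGroup H]
    [InnerProductSpace ℝ H] {DR DS : Set H} {R S : H → H} (hS : ChordProperty (SRG DS S)) :
    SRG (DR ∩ DS) (fun u => R u + S u) ⊆ SRG DR R + SRG DS S := by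
  intro z hz
  obtain ⟨u₁, hu₁, u₂, hu₂, hne, hz⟩ := mem_SRG_iff.1 hz
  obtain ⟨hre, him⟩ := (mem_zRel_iff hne z).1 hz
  have hsum : R u₁ + S u₁ - (R u₂ + S u₂) = (R u₁ - R u₂) + (S u₁ - S u₂) := by abel
  simp only [hsum, inner_add_right, add_div, add_smul, add_sub_add_comm] at hre him
  have hR := mem_zRel_iff (R := R) hne
  have hS' := mem_zRel_iff (R := S) hne
  set u := u₁ - u₂
  set a := inner ℝ u (R u₁ - R u₂) / ‖u‖ ^ 2
  set b := inner ℝ u (S u₁ - S u₂) / ‖u‖ ^ 2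
  set p := R u₁ - R u₂ - a • u
  set q := S u₁ - S u₂ - b • u
  have hP : 0 ≤ ‖p‖ / ‖u‖ := by positivity
  have hQ : 0 ≤ ‖q‖ / ‖u‖ := by positivity
  have hupper : |z.im| ≤ ‖p‖ / ‖u‖ + ‖q‖ / ‖u‖ := by
    rw [him, ← add_div]
    gcongr
    exact norm_add_le _ _
  have hlower : ‖p‖ / ‖u‖ ≤ |z.im| + ‖q‖ / ‖u‖ := by
    rw [him, ← add_div]
    gcongr
    exact norm_le_add_norm_add _ _
  have hSmem : (⟨b, ‖q‖ / ‖u‖⟩ : ℂ) ∈ SRG DS S :=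
    mem_SRG_iff.2 ⟨u₁, hu₁.2, u₂, hu₂.2, hne, (hS' _).2 ⟨rfl, abs_of_nonneg hQ⟩⟩
  obtain ⟨s, hs, hdiff⟩ : ∃ s : ℝ, |s| = ‖p‖ / ‖u‖ ∧ |z.im - s| ≤ ‖q‖ / ‖u‖ := by
    obtain h | h := le_total 0 z.im
    · rw [abs_of_nonneg h] at hupper hlower
      exact ⟨‖p‖ / ‖u‖, abs_of_nonneg hP, abs_le.2 ⟨by linarith, by linarith⟩⟩
    · rw [abs_of_nonpos h] at hupper hlower
      exact ⟨-(‖p‖ / ‖u‖), by rw [abs_neg, abs_of_nonneg hP],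
        abs_le.2 ⟨by linarith, by linarith⟩⟩
  refine ⟨⟨a, s⟩, mem_SRG_iff.2 ⟨u₁, hu₁.1, u₂, hu₂.1, hne, (hR _).2 ⟨rfl, hs⟩⟩,
    ⟨b, z.im - s⟩, ?_, ?_⟩
  · exact hS.mem_of_re_eq_of_abs_im_le hSmem rfl (hdiff.trans_eq (abs_of_nonneg hQ).symm)
  · exact Complex.ext hre.symm (add_sub_cancel _ _)

/-- If at least one of `SRG(R)`, `SRG(S)` satisfies the chord
property, then `SRG(R + S) ⊆ SRG(R) + SRG(S)` (Minkowski sum), where `R + S` is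
defined on `dom(R) ∩ dom(S)`. -/
theorem statement15 {H : Type*} [NormedAddCommGroup H] [InnerProductSpace ℝ H]
    (DR DS : Set H) (R S : H → H)
    (hchord : ChordProperty (SRG DR R) ∨ ChordProperty (SRG DS S)) :
    SRG (DR ∩ DS) (fun u => R u + S u) ⊆ SRG DR R + SRG DS S := by
  obtain hR | hS := hchord
  · rw [inter_comm, add_comm (SRG DR R)]
    simp_rw [add_comm (R _)]
    exact SRG_add_subset_of_chordProperty_right hR
  · exact SRG_add_subset_of_chordProperty_right hS
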